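/- Let d ≥ 3 and fix t ∈ (−1,1). Suppose there exists a unitary W ∈ U(d−1) such that, taking V_m = W for all m and A_m = S^{−(m−1)}(t ⊕ V_m)S^{m−1}, the family {A_m* A_n}_{m,n=1}^d is linearly independent. Then the set of single unitaries V ∈ U(d−1) for which, taking V_m = V for all m, the associated family {A_m* A_n}_{m,n=1}^d is linearly independent is a co-null set in U(d−1) with respect to the normalized Haar measure on U(d−1). -/

import Mathlib

open MeasureTheory Matrix

noncomputable section

/-- The cyclic shift matrix `S = ∑_k |e_k⟩⟨e_{k+1}|` (indices mod `d`). -/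
def cyclicShift (d : ℕ) : Matrix (Fin d) (Fin d) ℂ :=
  Matrix.of fun j k => if (k : ℕ) = ((j : ℕ) + 1) % d then 1 else 0

/-- The block-diagonal matrix `t ⊕ V ∈ M_d(ℂ)` with `(1,1)` entry `t` and lower-right
`(d−1)×(d−1)` block `V`. -/
def blockTV (d : ℕ) (t : ℂ) (V : Matrix (Fin (d - 1)) (Fin (d - 1)) ℂ) :
    Matrix (Fin d) (Fin d) ℂ :=
  Matrix.of fun j k =>
    if h : (j : ℕ) = 0 ∨ (k : ℕ) = 0 then
      (if (j : ℕ) = 0 ∧ (k : ℕ) = 0 then t else 0)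
    else V ⟨(j : ℕ) - 1, by have := j.isLt; omega⟩ ⟨(k : ℕ) - 1, by have := k.isLt; omega⟩

/-- `A_m = S^{−(m−1)} (t ⊕ V_m) S^{m−1}` (with `m : Fin d` corresponding to
`m+1 ∈ {1,…,d}`). -/
def keyA (d : ℕ) (t : ℂ) (V : Fin d → Matrix (Fin (d - 1)) (Fin (d - 1)) ℂ) (m : Fin d) :
    Matrix (Fin d) (Fin d) ℂ :=
  ((cyclicShift d) ^ (m : ℕ))ᴴ * blockTV d t (V m) * (cyclicShift d) ^ (m : ℕ)

/-- The Borel σ-algebra on the unitary group `U(d−1)`. -/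
instance unitaryGroupMeasurableSpace (n : ℕ) :
    MeasurableSpace (Matrix.unitaryGroup (Fin n) ℂ) := borel _

instance unitaryGroupBorelSpace (n : ℕ) :
    BorelSpace (Matrix.unitaryGroup (Fin n) ℂ) := ⟨rfl⟩

open Set in
/-- On a second countable group, a continuous function that is analytic along the right translates
of one curve from `1` to each element and is not identically zero vanishes only on a null set of
any finite left-invariant measure. -/
theorem measure_zeroSet_eq_zero_of_analytic_curves {G : Type*} [Group G] [TopologicalSpace G]
    [IsTopologicalGroup G] [SecondCountableTopology G] [MeasurableSpace G] [BorelSpace G]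
    (μ : Measure G) [μ.IsMulLeftInvariant] [IsFiniteMeasure μ] {f : G → ℂ} (hf : Continuous f)
    (hcurve : ∀ g : G, ∃ γ : ℝ → G, Continuous γ ∧ γ 0 = 1 ∧ γ 1 = g ∧
      ∀ v, AnalyticOnNhd ℝ (fun s => f (γ s * v)) univ)
    {w : G} (hw : f w ≠ 0) : μ {v | f v = 0} = 0 := by
  choose γ hγ hγ0 hγ1 hγa using hcurve
  let N : G → Set G := fun g => {v | ∀ s, f (γ g s * v) = 0}
  have hZ : IsClosed {v | f v = 0} := isClosed_eq hf continuous_const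
  have hN : ∀ g, IsClosed (N g) := fun g => by
    simp only [N, ofPred_forall]
    exact isClosed_iInter fun s => isClosed_eq (by fun_prop) continuous_const
  have hNZ : ∀ g, N g ⊆ {v | f v = 0} := fun g v hv => by
    have := hv 0
    rwa [hγ0, one_mul] at this
  have hdiff : ∀ g, μ ({v | f v = 0} \ N g) = 0 := fun g => by
    rw [measure_sdiff (hNZ g) (hN g).measurableSet.nullMeasurableSet (measure_ne_top _ _),
      tsub_eq_zero_iff_le]
    let ν : Measure ℝ := volume.restrict (Icc 0 1)
    let E : Set (ℝ × G) := {p | f (γ g p.1 * p.2) = 0}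
    have hE : MeasurableSet E :=
      (isClosed_eq (hf.comp (((hγ g).comp continuous_fst).mul continuous_snd))
        continuous_const).measurableSet
    have hleft : ν.prod μ E = μ {v | f v = 0} := by
      rw [Measure.prod_apply hE]
      have : ∀ s, μ (Prod.mk s ⁻¹' E) = μ {v | f v = 0} := fun s =>
        measure_preimage_mul μ (γ g s) {v | f v = 0}
      simp [this, ν]
    have hright : ν.prod μ E ≤ μ (N g) := by
      rw [Measure.prod_apply_symm hE, ← lintegral_indicator_one (hN g).measurableSet]
      refine lintegral_mono fun v => ?_
      by_cases hv : v ∈ N g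
      · simp only [indicator_of_mem hv, Pi.one_apply]
        exact (measure_mono (subset_univ _)).trans (by simp [ν])
      · obtain ⟨s, hs⟩ := not_forall.mp hv
        have h1 := (hγa g v).preimage_zero_mem_codiscrete hs
        have h2 : ∀ᵐ s, f (γ g s * v) ≠ 0 := by
          have := ae_restrict_le_codiscreteWithin (μ := (volume : Measure ℝ))
            MeasurableSet.univ h1
          rw [Measure.restrict_univ] at this
          exact this
        have h3 : ν ((fun s => (s, v)) ⁻¹' E) = 0 :=
          (compl_mem_ae_iff (μ := ν)).1 (ae_restrict_of_ae h2)
        exact h3.le.trans zero_le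
    exact hleft ▸ hright
  obtain ⟨D, hDc, hDd⟩ := TopologicalSpace.exists_countable_dense G
  refine measure_mono_null (fun v hv => ?_) ((measure_biUnion_null_iff hDc).2 fun g _ => hdiff g)
  have hopen : IsOpen {g | f (g * v) ≠ 0} :=
    isOpen_ne_fun (hf.comp (continuous_mul_const v)) continuous_const
  obtain ⟨g, hg, hgD⟩ := hDd.inter_open_nonempty _ hopen ⟨w * v⁻¹, by simpa using hw⟩
  refine mem_iUnion₂.2 ⟨g, hgD, hv, fun hgv => hg ?_⟩
  have := hgv 1
  rwa [hγ1] at this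

open scoped Matrix.Norms.L2Operator in
/-- Every unitary matrix is `exp (i h)` for some Hermitian matrix `h`. -/
theorem exists_expUnitary_eq {n : Type*} [Fintype n] [DecidableEq n] (u : unitaryGroup n ℂ) :
    ∃ h : selfAdjoint (Matrix n n ℂ), selfAdjoint.expUnitary h = u := by
  refine ⟨Unitary.argSelfAdjoint u, Subtype.ext ?_⟩
  have : ContinuousOn Complex.arg (spectrum ℂ (u : Matrix n n ℂ)) :=
    (Matrix.finite_spectrum _).continuousOn _
  rw [selfAdjoint.expUnitary_coe, Unitary.argSelfAdjoint_coe,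
    ← CFC.exp_eq_normedSpace_exp (𝕜 := ℂ), ← cfc_comp_smul .., ← cfc_comp' ..]
  conv_rhs => rw [← cfc_id' ℂ (u : Matrix n n ℂ)]
  refine cfc_congr fun y hy => ?_
  have hy₁ : ‖y‖ = 1 := spectrum.norm_eq_one_of_unitary u.2 hy
  have : Complex.I * y.arg = Complex.log y :=
    Complex.ext (by simp [Complex.log_re, hy₁]) (by simp [Complex.log_im])
  simpa [← Complex.exp_eq_exp_ℂ, this] using Complex.exp_log (by aesop)

/-- A curve of matrices all of whose entries are real-analytic. -/
def EntrywiseAnalytic {m n : Type*} (M : ℝ → Matrix m n ℂ) : Prop :=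
  ∀ i j, AnalyticOnNhd ℝ (fun s => M s i j) Set.univ

namespace EntrywiseAnalytic

variable {l m n : Type*}

theorem const (A : Matrix m n ℂ) : EntrywiseAnalytic fun _ => A :=
  fun _ _ => analyticOnNhd_const

theorem mul [Fintype m] {M : ℝ → Matrix l m ℂ} {N : ℝ → Matrix m n ℂ}
    (hM : EntrywiseAnalytic M) (hN : EntrywiseAnalytic N) :
    EntrywiseAnalytic fun s => M s * N s := fun i j => by
  simp only [Matrix.mul_apply]
  exact Finset.analyticOnNhd_fun_sum _ fun k _ => (hM i k).mul (hN k j)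

theorem conjTranspose {M : ℝ → Matrix m n ℂ} (hM : EntrywiseAnalytic M) :
    EntrywiseAnalytic fun s => (M s)ᴴ := fun i j s _ =>
  (Complex.conjCLE.toContinuousLinearMap.analyticAt _).comp (hM j i s trivial)

theorem det [Fintype n] [DecidableEq n] {M : ℝ → Matrix n n ℂ} (hM : EntrywiseAnalytic M) :
    AnalyticOnNhd ℝ (fun s => (M s).det) Set.univ := by
  simp only [Matrix.det_apply']
  exact Finset.analyticOnNhd_fun_sum _ fun σ _ =>
    analyticOnNhd_const.mul (Finset.analyticOnNhd_fun_prod _ fun i _ => hM _ _)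

open scoped Matrix.Norms.Operator in
theorem exp_smul [Fintype n] [DecidableEq n] (A : Matrix n n ℂ) :
    EntrywiseAnalytic fun s => NormedSpace.exp (s • A) := fun i j s _ => by
  have h : AnalyticAt ℝ (fun s : ℝ => NormedSpace.exp (s • A)) s :=
    AnalyticAt.fun_comp (g := NormedSpace.exp) (f := fun s : ℝ => s • A)
      (NormedSpace.exp_analytic (s • A)) (analyticAt_id.smul analyticAt_const)
  exact ((Matrix.entryLinearMap ℝ ℂ i j).toContinuousLinearMap.analyticAt _).comp h

theorem blockTV {d : ℕ} {t : ℂ} {V : ℝ → Matrix (Fin (d - 1)) (Fin (d - 1)) ℂ}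
    (hV : EntrywiseAnalytic V) : EntrywiseAnalytic fun s => blockTV d t (V s) := fun i j => by
  by_cases h : (i : ℕ) = 0 ∨ (j : ℕ) = 0
  · simp only [_root_.blockTV, Matrix.of_apply, dif_pos h]
    exact analyticOnNhd_const
  · simp only [_root_.blockTV, Matrix.of_apply, dif_neg h]
    exact hV _ _

theorem keyA {d : ℕ} {t : ℂ} {V : ℝ → Matrix (Fin (d - 1)) (Fin (d - 1)) ℂ}
    (hV : EntrywiseAnalytic V) (m : Fin d) :
    EntrywiseAnalytic fun s => keyA d t (fun _ => V s) m :=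
  ((const _).mul hV.blockTV).mul (const _)

end EntrywiseAnalytic

theorem continuous_keyA (d : ℕ) (t : ℂ) (m : Fin d) :
    Continuous fun V : Matrix (Fin (d - 1)) (Fin (d - 1)) ℂ => keyA d t (fun _ => V) m := by
  have : Continuous fun V : Matrix (Fin (d - 1)) (Fin (d - 1)) ℂ => blockTV d t V := by
    refine continuous_matrix fun i j => ?_
    by_cases h : (i : ℕ) = 0 ∨ (j : ℕ) = 0
    · simp only [blockTV, Matrix.of_apply, dif_pos h]
      exact continuous_const
    · simp only [blockTV, Matrix.of_apply, dif_neg h]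
      fun_prop
  unfold keyA
  fun_prop

/-- The square matrix whose rows are the flattened products `A_m* A_n`, for a single `V`. -/
def productRows (d : ℕ) (t : ℂ) (V : Matrix (Fin (d - 1)) (Fin (d - 1)) ℂ) :
    Matrix (Fin d × Fin d) (Fin d × Fin d) ℂ :=
  Matrix.of fun p q => ((keyA d t (fun _ => V) p.1)ᴴ * keyA d t (fun _ => V) p.2) q.1 q.2

theorem linearIndependent_iff_det_productRows_ne_zero (d : ℕ) (t : ℂ)
    (V : Matrix (Fin (d - 1)) (Fin (d - 1)) ℂ) :
    LinearIndependent ℂ (fun p : Fin d × Fin d =>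
      (keyA d t (fun _ => V) p.1)ᴴ * keyA d t (fun _ => V) p.2) ↔ (productRows d t V).det ≠ 0 := by
  rw [← isUnit_iff_ne_zero, ← Matrix.isUnit_iff_isUnit_det,
    ← Matrix.linearIndependent_rows_iff_isUnit]
  let e : Matrix (Fin d) (Fin d) ℂ ≃ₗ[ℂ] (Fin d × Fin d → ℂ) :=
    (LinearEquiv.curry ℂ ℂ (Fin d) (Fin d)).symm
  exact (e.toLinearMap.linearIndependent_iff e.ker).symm

theorem continuous_det_productRows (d : ℕ) (t : ℂ) :
    Continuous fun V => (productRows d t V).det := by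
  refine Continuous.matrix_det (continuous_matrix fun p q => ?_)
  exact ((continuous_keyA d t p.1).matrix_conjTranspose.matrix_mul
    (continuous_keyA d t p.2)).matrix_elem q.1 q.2

theorem EntrywiseAnalytic.det_productRows {d : ℕ} {t : ℂ}
    {V : ℝ → Matrix (Fin (d - 1)) (Fin (d - 1)) ℂ} (hV : EntrywiseAnalytic V) :
    AnalyticOnNhd ℝ (fun s => (productRows d t (V s)).det) Set.univ :=
  EntrywiseAnalytic.det fun p q => ((hV.keyA p.1).conjTranspose.mul (hV.keyA p.2)) q.1 q.2

open scoped Matrix.Norms.L2Operator in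
/-- Every unitary matrix is joined to `1` by a continuous curve of unitary matrices with
real-analytic entries. -/
theorem exists_analytic_curve_unitaryGroup {n : Type*} [Fintype n] [DecidableEq n]
    (u : unitaryGroup n ℂ) :
    ∃ γ : ℝ → unitaryGroup n ℂ, Continuous γ ∧ γ 0 = 1 ∧ γ 1 = u ∧
      EntrywiseAnalytic fun s => (γ s : Matrix n n ℂ) := by
  obtain ⟨h, rfl⟩ := exists_expUnitary_eq u
  refine ⟨fun s => selfAdjoint.expUnitary (s • h),
    selfAdjoint.continuous_expUnitary.comp (continuous_id.smul continuous_const),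
    by simp, by simp, ?_⟩
  convert! EntrywiseAnalytic.exp_smul (Complex.I • (h : Matrix n n ℂ)) using 2 with s
  rw [selfAdjoint.expUnitary_coe, selfAdjoint.val_smul, smul_comm]

/-- Suppose for some single unitary `W ∈ U(d−1)` (used for all `V_m`) the family
`{A_m* A_n}` is linearly independent. Then the set of single unitaries `V ∈ U(d−1)`
for which (taking `V_m = V` for all `m`) the family `{A_m* A_n}` is linearly dependent
is a null set for the normalized Haar measure on `U(d−1)`. -/
theorem linearIndependent_coNull_single (d : ℕ) (hd : 3 ≤ d) (t : ℝ)
    (ht : t ∈ Set.Ioo (-1 : ℝ) 1)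
    (hW : ∃ W : Matrix (Fin (d - 1)) (Fin (d - 1)) ℂ,
      W ∈ Matrix.unitaryGroup (Fin (d - 1)) ℂ ∧
      LinearIndependent ℂ (fun p : Fin d × Fin d =>
        (keyA d (t : ℂ) (fun _ => W) p.1)ᴴ * keyA d (t : ℂ) (fun _ => W) p.2))
    (μ : Measure (Matrix.unitaryGroup (Fin (d - 1)) ℂ))
    (hHaar : μ.IsHaarMeasure) (hProb : IsProbabilityMeasure μ) :
    μ {V : Matrix.unitaryGroup (Fin (d - 1)) ℂ |
        ¬ LinearIndependent ℂ (fun p : Fin d × Fin d =>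
          (keyA d (t : ℂ) (fun _ => (V : Matrix (Fin (d - 1)) (Fin (d - 1)) ℂ)) p.1)ᴴ *
            keyA d (t : ℂ) (fun _ => (V : Matrix (Fin (d - 1)) (Fin (d - 1)) ℂ)) p.2)} = 0 := by
  obtain ⟨W, hWu, hW⟩ := hW
  have : SecondCountableTopology (Matrix (Fin (d - 1)) (Fin (d - 1)) ℂ) :=
    inferInstanceAs (SecondCountableTopology (Fin (d - 1) → Fin (d - 1) → ℂ))
  have : SecondCountableTopology (unitaryGroup (Fin (d - 1)) ℂ) :=
    TopologicalSpace.Subtype.secondCountableTopology _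
  simp only [linearIndependent_iff_det_productRows_ne_zero, not_not] at hW ⊢
  refine measure_zeroSet_eq_zero_of_analytic_curves μ
    (f := fun V => (productRows d t (V : Matrix (Fin (d - 1)) (Fin (d - 1)) ℂ)).det)
    ((continuous_det_productRows d t).comp continuous_subtype_val) (fun g => ?_)
    (w := ⟨W, hWu⟩) hW
  obtain ⟨γ, hγ, hγ0, hγ1, hγa⟩ := exists_analytic_curve_unitaryGroup g
  exact ⟨γ, hγ, hγ0, hγ1, fun v => (hγa.mul (.const _)).det_productRows⟩

end
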